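/- For every finite digraph D (an irreflexive relation on a finite vertex set, where 2-cycles are allowed), the minimum size τ(D) of a feedback arc set satisfies τ(D) ≥ ½·δ⁺(D)·(δ⁺(D)+1). -/

import Mathlib

/-- `c` is a directed cycle of the digraph with arc relation `A` (2-cycles allowed):
a list of pairwise distinct vertices, of length at least 2, with consecutive
arcs present and a closing arc from the last vertex back to the first. -/
def IsCycle {V : Type*} (A : V → V → Prop) (c : List V) : Prop :=
  c.Nodup ∧ 2 ≤ c.length ∧ List.Chain' A c ∧
    ∀ h : c ≠ [], A (c.getLast h) (c.head h)

/-- `S` is a feedback arc set of the digraph with arc relation `A`: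
a set of arcs whose removal leaves an acyclic digraph. -/
def IsFeedbackArcSet {V : Type*} (A : V → V → Prop) (S : Finset (V × V)) : Prop :=
  (∀ e ∈ S, A e.1 e.2) ∧
    ∀ c : List V, ¬ IsCycle (fun x y => A x y ∧ (x, y) ∉ S) c

/-- The out-degree of a vertex. -/
def outDeg {V : Type*} [Fintype V] (A : V → V → Prop) [DecidableRel A] (v : V) : ℕ :=
  (Finset.univ.filter (fun u => A v u)).card

/-- A nonempty finite set in which every vertex has an out-neighbour other than itself
contains a directed cycle. -/
theorem exists_isCycle_of_forall_exists_succ {V : Type*} (B : V → V → Prop)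
    (hirr : ∀ x, ¬ B x x) (T : Finset V) (hT : T.Nonempty)
    (h : ∀ v ∈ T, ∃ u ∈ T, B v u) : ∃ c : List V, IsCycle B c := by
  choose! f hfT hfB using h
  obtain ⟨x, hx⟩ := hT
  have hmem : ∀ i, f^[i] x ∈ T := fun i => by
    induction i with
    | zero => exact hx
    | succ i ih => rw [Function.iterate_succ_apply']; exact hfT _ ih
  obtain ⟨i, j, hij, heq⟩ : ∃ i j, i < j ∧ f^[i] x = f^[j] x := by
    obtain ⟨i, j, hne, heq⟩ := Finite.exists_ne_map_eq_of_infinite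
      (fun i : ℕ => (⟨f^[i] x, hmem i⟩ : T))
    have heq' : f^[i] x = f^[j] x := congrArg Subtype.val heq
    rcases lt_or_gt_of_ne hne with hlt | hlt
    · exact ⟨i, j, hlt, heq'⟩
    · exact ⟨j, i, hlt, heq'.symm⟩
  set y := f^[i] x with hy
  have hyT : ∀ k, f^[k] y ∈ T := fun k => by
    rw [hy, ← Function.iterate_add_apply]; exact hmem _
  have hper : Function.IsPeriodicPt f (j - i) y := by
    change f^[j - i] y = y
    conv_lhs => rw [hy]
    rw [← Function.iterate_add_apply, Nat.sub_add_cancel hij.le, ← heq]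
  have hpos : 0 < Function.minimalPeriod f y := hper.minimalPeriod_pos (by omega)
  have hiter : f^[Function.minimalPeriod f y] y = y := Function.isPeriodicPt_minimalPeriod f y
  have harc : ∀ k, B (f^[k] y) (f^[k + 1] y) := fun k => by
    rw [Function.iterate_succ_apply']; exact hfB _ (hyT k)
  have hne : Function.minimalPeriod f y ≠ 1 := fun h1 => by
    rw [h1] at hiter
    have hloop : B y (f^[1] y) := harc 0
    exact hirr y (by rwa [hiter] at hloop)
  refine ⟨(List.range (Function.minimalPeriod f y)).map (fun k => f^[k] y), ?_, ?_, ?_, ?_⟩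
  · refine List.Nodup.map_on (fun a ha b hb hab => ?_) List.nodup_range
    exact Function.iterate_injOn_Iio_minimalPeriod (by simpa using ha) (by simpa using hb) hab
  · simp only [List.length_map, List.length_range]; omega
  · refine List.isChain_iff_getElem.2 fun k hk => ?_
    simpa using harc k
  · intro hnil
    have := harc (Function.minimalPeriod f y - 1)
    rw [Nat.sub_add_cancel hpos, hiter] at this
    simpa [List.getLast_eq_getElem, List.head_eq_getElem] using this

/-- Listing vertices greedily, each without unlisted out-neighbours outside `S`, the first `k` of
them are tails of at least `δ + (δ - 1) + ⋯ + (δ - k + 1)` arcs of a feedback arc set `S`. -/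
theorem IsFeedbackArcSet.exists_card_eq_and_le {V : Type*} [Fintype V] [DecidableEq V]
    {A : V → V → Prop} [DecidableRel A] (hirr : ∀ x, ¬ A x x) {δ : ℕ}
    (hδ : ∀ v : V, δ ≤ outDeg A v) {S : Finset (V × V)} (hS : IsFeedbackArcSet A S)
    (k : ℕ) (hk : k ≤ Fintype.card V) :
    ∃ P : Finset V, P.card = k ∧
      k * (2 * δ + 1) ≤ 2 * (S.filter (fun e => e.1 ∈ P)).card + k * k := by
  induction k with
  | zero => exact ⟨∅, by simp⟩
  | succ k ih =>
    obtain ⟨P, hPk, hP⟩ := ih (by omega)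
    obtain ⟨v, hvP, hv⟩ : ∃ v ∉ P, ∀ u ∉ P, ¬ (A v u ∧ (v, u) ∉ S) := by
      by_contra! hcon
      obtain ⟨c, hc⟩ := exists_isCycle_of_forall_exists_succ
        (fun x y => A x y ∧ (x, y) ∉ S) (fun x hx => hirr x hx.1) Pᶜ
        (by rw [← Finset.card_pos, Finset.card_compl]; omega)
        (by simpa using hcon)
      exact hS.2 c hc
    refine ⟨insert v P, by rw [Finset.card_insert_of_notMem hvP, hPk], ?_⟩
    have hout : δ ≤ k + (S.filter (fun e => e.1 = v)).card := calc
      δ ≤ (Finset.univ.filter (fun u => A v u)).card := hδ v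
      _ ≤ (P ∪ (S.filter (fun e => e.1 = v)).image Prod.snd).card := by
        refine Finset.card_le_card fun u hu => ?_
        have hAu : A v u := by simpa using hu
        by_cases huP : u ∈ P
        · simp [huP]
        · have huS : (v, u) ∈ S := by_contra fun hn => hv u huP ⟨hAu, hn⟩
          simp [huP, huS]
      _ ≤ k + (S.filter (fun e => e.1 = v)).card :=
        (Finset.card_union_le _ _).trans (by rw [hPk]; gcongr; exact Finset.card_image_le)
    have hsplit : (S.filter (fun e => e.1 ∈ insert v P)).card =
        (S.filter (fun e => e.1 = v)).card + (S.filter (fun e => e.1 ∈ P)).card := by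
      simp only [Finset.mem_insert, Finset.filter_or]
      refine Finset.card_union_of_disjoint (Finset.disjoint_filter.2 ?_)
      rintro e - rfl
      exact hvP
    rw [hsplit]
    linarith

/-- Remark 3: for every finite digraph `D`,
`τ(D) ≥ δ⁺(D)(δ⁺(D)+1)/2`, stated as: every feedback arc set `S` satisfies
`δ⁺(D)(δ⁺(D)+1) ≤ 2 |S|`. -/
theorem feedback_arc_set_lower_bound {V : Type*} [Fintype V]
    (A : V → V → Prop) [DecidableRel A]
    (hirr : ∀ x, ¬ A x x)
    (δ : ℕ)
    (hδ_mem : ∃ v : V, outDeg A v = δ)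
    (hδ_min : ∀ v : V, δ ≤ outDeg A v)
    (S : Finset (V × V)) (hS : IsFeedbackArcSet A S) :
    δ * (δ + 1) ≤ 2 * S.card := by
  classical
  obtain ⟨v, hv⟩ := hδ_mem
  have hcard : δ ≤ Fintype.card V := hv ▸ Finset.card_le_univ _
  obtain ⟨P, -, hP⟩ := hS.exists_card_eq_and_le hirr hδ_min δ hcard
  have hle := Finset.card_filter_le S (fun e => e.1 ∈ P)
  linarith
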